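/- arXiv:1210.7773 — 2 statements merged into one kernel-verified Lean document; each statement's English description precedes it below -/
import Mathlib

section
/- For every m ≥ k, the joint distribution under μ of (Y₁, Y₂, …, Y_m) on ℝ^m is not a Gaussian measure (i.e., there exists a continuous linear functional on ℝ^m whose pushforward of this joint distribution is not a one-dimensional Gaussian measure); in particular the process {Y_n} is not a Gaussian process. -/
open Real MeasureTheory ProbabilityTheory

/-- The density `ψ` of the measure `ν` on `ℝ^k`. -/
noncomputable def psi (k : ℕ) (x : Fin k → ℝ) : ℝ :=
  (2 * Real.pi) ^ (-(k : ℝ) / 2) *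
    (1 + (∏ i, x i) * Real.exp (-(∑ i, x i ^ 2) / 2)) *
    Real.exp (-(∑ i, x i ^ 2) / 2)

/-- The measure `ν` on `ℝ^k` with density `ψ` with respect to Lebesgue measure. -/
noncomputable def nu (k : ℕ) : Measure (Fin k → ℝ) :=
  (volume : Measure (Fin k → ℝ)).withDensity fun x => ENNReal.ofReal (psi k x)

/-- `μ` is the joint law of an i.i.d. bilateral sequence `(X_{n,1},…,X_{n,k})`,
`n ∈ ℤ`, with common distribution `ν`: every finite-dimensional marginal of `μ`
is the corresponding finite product of copies of `ν`. -/
def IsIIDSeq (k : ℕ) (μ : Measure (ℤ → Fin k → ℝ)) : Prop :=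
  ∀ I : Finset ℤ, μ.map I.restrict = Measure.pi fun _ : I => nu k

/-- `Y n = X_{n,k} + X_{n+1,k-1} + ⋯ + X_{n+k-1,1}` (coordinates indexed by
`Fin k`, so coordinate `i ∈ {1,…,k}` corresponds to index `i-1 : Fin k`). -/
noncomputable def Y (k : ℕ) (n : ℤ) (ω : ℤ → Fin k → ℝ) : ℝ :=
  ∑ j : Fin k, ω (n + ((j : ℕ) : ℤ)) j.rev

/-- A measure on `ℝ^m` is Gaussian if its pushforward under every continuous
linear functional is a (possibly degenerate) one-dimensional Gaussian measure. -/
def IsGaussianMeasure {m : ℕ} (P : Measure (Fin m → ℝ)) : Prop :=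
  ∀ L : (Fin m → ℝ) →L[ℝ] ℝ, ∃ (a : ℝ) (v : NNReal), P.map L = gaussianReal a v

lemma psi_nonneg (k : ℕ) (x : Fin k → ℝ) : 0 ≤ psi k x := by
  have hbound (y : ℝ) : |y * Real.exp (-y ^ 2 / 2)| ≤ 1 := by
    rw [abs_mul, Real.abs_exp, neg_div, Real.exp_neg, ← div_eq_mul_inv, div_le_one (Real.exp_pos _)]
    have := Real.add_one_le_exp (y ^ 2 / 2)
    nlinarith [sq_nonneg (|y| - 1), sq_abs y]
  have hprod : |(∏ i, x i) * Real.exp (-(∑ i, x i ^ 2) / 2)| ≤ 1 := by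
    rw [← Finset.sum_neg_distrib, Finset.sum_div, Real.exp_sum, ← Finset.prod_mul_distrib,
      Finset.abs_prod]
    exact Finset.prod_le_one (fun _ _ => abs_nonneg _) fun i _ => hbound (x i)
  have := (abs_le.mp hprod).1
  unfold psi
  have : 0 ≤ 1 + (∏ i, x i) * Real.exp (-(∑ i, x i ^ 2) / 2) := by linarith
  positivity

lemma measurable_psi (k : ℕ) : Measurable (psi k) := by
  unfold psi
  fun_prop

instance sigmaFinite_nu (k : ℕ) : SigmaFinite (nu k) :=
  SigmaFinite.withDensity_of_ne_top (by simp)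

lemma integral_gaussian_mul_cexp (t : ℝ) :
    ∫ x : ℝ, (((2 * π) ^ (-(1 / 2) : ℝ) * Real.exp (-x ^ 2 / 2) : ℝ) : ℂ) *
      Complex.exp (Complex.I * t * x) = Complex.exp (-t ^ 2 / 2) := by
  have h := fourierIntegral_gaussian (b := 1 / 2) (by norm_num) t
  have hc : ((2 * π) ^ (-(1 / 2) : ℝ) : ℝ) * (π / (1 / 2) : ℂ) ^ (1 / 2 : ℂ) = 1 := by
    have hpi : (π / (1 / 2) : ℂ) = ((2 * π : ℝ) : ℂ) := by push_cast; ring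
    rw [hpi, show (1 / 2 : ℂ) = ((1 / 2 : ℝ) : ℂ) by norm_num, ← Complex.ofReal_cpow (by positivity),
      ← Complex.ofReal_mul, ← Real.rpow_add (by positivity)]
    simp
  calc _ = ∫ x : ℝ, (((2 * π) ^ (-(1 / 2) : ℝ) : ℝ) : ℂ) *
        (Complex.exp (Complex.I * t * x) * Complex.exp (-(1 / 2) * x ^ 2)) := by
        congr 1 with x
        push_cast
        ring_nf
    _ = Complex.exp (-t ^ 2 / 2) := by
        rw [integral_const_mul, h, ← mul_assoc, hc]
        norm_num

lemma integrable_gaussian_mul_cexp (t : ℝ) :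
    Integrable fun x : ℝ => (((2 * π) ^ (-(1 / 2) : ℝ) * Real.exp (-x ^ 2 / 2) : ℝ) : ℂ) *
      Complex.exp (Complex.I * t * x) := by
  have h := (integrable_cexp_quadratic (b := 1 / 2) (by norm_num) (Complex.I * t) 0).const_mul
    (((2 * π) ^ (-(1 / 2) : ℝ) : ℝ) : ℂ)
  refine h.congr (.of_forall fun x => ?_)
  push_cast
  rw [mul_assoc _ (Complex.exp _) (Complex.exp _), ← Complex.exp_add]
  ring_nf

lemma integrable_mul_gaussian_mul_cexp (t : ℝ) :
    Integrable fun x : ℝ => (x : ℂ) * (Complex.exp (-x ^ 2) * Complex.exp (Complex.I * t * x)) := by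
  have h := integrable_mul_cexp_neg_mul_sq (b := 1) (by norm_num)
  refine h.mono (by fun_prop) (.of_forall fun x => ?_)
  simp [Complex.norm_exp]

lemma integral_mul_gaussian_mul_cexp (t : ℝ) :
    ∫ x : ℝ, (x : ℂ) * (Complex.exp (-x ^ 2) * Complex.exp (Complex.I * t * x)) =
      Complex.I * t / 2 * ((√π : ℝ) * Complex.exp (-t ^ 2 / 4)) := by
  have hg : ∫ x : ℝ, Complex.exp (-x ^ 2) * Complex.exp (Complex.I * t * x) =
      (√π : ℝ) * Complex.exp (-t ^ 2 / 4) := by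
    have h := fourierIntegral_gaussian (b := 1) (by norm_num) t
    have hpi : (π / 1 : ℂ) ^ (1 / 2 : ℂ) = (√π : ℝ) := by
      rw [div_one, show (1 / 2 : ℂ) = ((1 / 2 : ℝ) : ℂ) by norm_num,
        ← Complex.ofReal_cpow (by positivity), Real.sqrt_eq_rpow]
    rw [hpi] at h
    simpa [mul_comm] using h
  have hint : Integrable fun x : ℝ =>
      Complex.exp (-x ^ 2) * Complex.exp (Complex.I * t * x) := by
    refine (integrable_cexp_quadratic (b := 1) (by norm_num) (Complex.I * t) 0).congr
      (.of_forall fun x => ?_)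
    dsimp only
    rw [← Complex.exp_add]
    ring_nf
  have hderiv (x : ℝ) : HasDerivAt
      (fun x : ℝ => Complex.exp (-x ^ 2) * Complex.exp (Complex.I * t * x))
      (Complex.I * t * (Complex.exp (-x ^ 2) * Complex.exp (Complex.I * t * x)) -
        2 * (x * (Complex.exp (-x ^ 2) * Complex.exp (Complex.I * t * x)))) x := by
    have hx : HasDerivAt (fun x : ℝ => (x : ℂ)) 1 x := Complex.ofRealCLM.hasDerivAt
    convert! ((hx.pow 2).neg.cexp).mul ((hx.const_mul (Complex.I * t)).cexp) using 1
    simp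
    ring
  have hzero := integral_eq_zero_of_hasDerivAt_of_integrable hderiv
    ((hint.const_mul _).sub ((integrable_mul_gaussian_mul_cexp t).const_mul _)) hint
  rw [integral_sub (hint.const_mul _) ((integrable_mul_gaussian_mul_cexp t).const_mul _),
    integral_const_mul, integral_const_mul, hg] at hzero
  linear_combination -(1 / 2) * hzero

lemma integral_normalized_mul_gaussian_mul_cexp (t : ℝ) :
    ∫ x : ℝ, (((2 * π) ^ (-(1 / 2) : ℝ) * (x * Real.exp (-x ^ 2)) : ℝ) : ℂ) *
      Complex.exp (Complex.I * t * x) =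
      Complex.I * t / (2 * (√2 : ℝ)) * Complex.exp (-t ^ 2 / 4) := by
  have hc : (2 * π) ^ (-(1 / 2) : ℝ) * √π = (√2)⁻¹ := by
    rw [Real.rpow_neg (by positivity), ← Real.sqrt_eq_rpow, Real.sqrt_mul (by norm_num)]
    field_simp
  calc _ = ∫ x : ℝ, (((2 * π) ^ (-(1 / 2) : ℝ) : ℝ) : ℂ) *
        ((x : ℂ) * (Complex.exp (-x ^ 2) * Complex.exp (Complex.I * t * x))) := by
        congr 1 with x
        push_cast
        ring
    _ = Complex.I * t / 2 * Complex.exp (-t ^ 2 / 4) *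
          (((2 * π) ^ (-(1 / 2) : ℝ) * √π : ℝ) : ℂ) := by
        rw [integral_const_mul, integral_mul_gaussian_mul_cexp]
        push_cast
        ring
    _ = _ := by
        rw [hc]
        push_cast
        field_simp

/-- The characteristic function of `ν`. -/
lemma integral_cexp_nu (k : ℕ) (t : Fin k → ℝ) :
    ∫ x, Complex.exp (Complex.I * ∑ j, (t j : ℂ) * x j) ∂nu k =
      ∏ j, Complex.exp (-t j ^ 2 / 2) +
        ∏ j, (Complex.I * t j / (2 * (√2 : ℝ)) * Complex.exp (-t j ^ 2 / 4)) := by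
  rw [nu, integral_withDensity_eq_integral_toReal_smul (measurable_psi k).ennreal_ofReal (by simp)]
  have hA : (2 * π) ^ (-(k : ℝ) / 2) = ((2 * π) ^ (-(1 / 2) : ℝ)) ^ k := by
    rw [← Real.rpow_natCast, ← Real.rpow_mul (by positivity)]
    ring_nf
  have hsplit (x : Fin k → ℝ) : (ENNReal.ofReal (psi k x)).toReal •
      Complex.exp (Complex.I * ∑ j, (t j : ℂ) * x j) =
      ∏ j, ((((2 * π) ^ (-(1 / 2) : ℝ) * Real.exp (-x j ^ 2 / 2) : ℝ) : ℂ) *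
        Complex.exp (Complex.I * t j * x j)) +
      ∏ j, ((((2 * π) ^ (-(1 / 2) : ℝ) * (x j * Real.exp (-x j ^ 2)) : ℝ) : ℂ) *
        Complex.exp (Complex.I * t j * x j)) := by
    have hexp : Complex.exp (Complex.I * ∑ j, (t j : ℂ) * x j) =
        ∏ j, Complex.exp (Complex.I * t j * x j) := by
      rw [Finset.mul_sum, Complex.exp_sum]
      simp only [mul_assoc]
    have hgauss : Real.exp (-(∑ i, x i ^ 2) / 2) = ∏ j, Real.exp (-x j ^ 2 / 2) := by
      rw [← Finset.sum_neg_distrib, Finset.sum_div, Real.exp_sum]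
    have hsq : ∏ j, Real.exp (-x j ^ 2) =
        (∏ j, Real.exp (-x j ^ 2 / 2)) * ∏ j, Real.exp (-x j ^ 2 / 2) := by
      rw [← Finset.prod_mul_distrib]
      refine Finset.prod_congr rfl fun j _ => ?_
      rw [← Real.exp_add]
      ring_nf
    rw [ENNReal.toReal_ofReal (psi_nonneg k x), psi, hgauss, hA, hexp, Complex.real_smul,
      Finset.prod_mul_distrib, Finset.prod_mul_distrib, ← add_mul, ← Complex.ofReal_prod,
      ← Complex.ofReal_prod, ← Complex.ofReal_add]
    congr 2
    rw [Finset.prod_mul_distrib, Finset.prod_mul_distrib, Finset.prod_mul_distrib, hsq]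
    simp
    ring
  simp_rw [hsplit]
  have hint (t : ℝ) : Integrable fun x : ℝ =>
      (((2 * π) ^ (-(1 / 2) : ℝ) * (x * Real.exp (-x ^ 2)) : ℝ) : ℂ) *
        Complex.exp (Complex.I * t * x) := by
    refine ((integrable_mul_gaussian_mul_cexp t).const_mul
      (((2 * π) ^ (-(1 / 2) : ℝ) : ℝ) : ℂ)).congr (.of_forall fun x => ?_)
    push_cast
    ring
  rw [volume_pi, integral_add (Integrable.fintype_prod fun j => integrable_gaussian_mul_cexp (t j))
    (Integrable.fintype_prod fun j => hint (t j)),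
    integral_fintype_prod_eq_prod (fun j (x : ℝ) =>
      (((2 * π) ^ (-(1 / 2) : ℝ) * Real.exp (-x ^ 2 / 2) : ℝ) : ℂ) *
        Complex.exp (Complex.I * t j * x)),
    integral_fintype_prod_eq_prod (fun j (x : ℝ) =>
      (((2 * π) ^ (-(1 / 2) : ℝ) * (x * Real.exp (-x ^ 2)) : ℝ) : ℂ) *
        Complex.exp (Complex.I * t j * x))]
  simp_rw [integral_gaussian_mul_cexp, integral_normalized_mul_gaussian_mul_cexp]

/-- The two sides have different orders of growth as `u → ∞`. -/
lemma not_forall_exp_mul_sq_eq_norm {k : ℕ} (hk : k ≠ 0) {a : ℝ} (ha : 0 < a) (β : ℝ) :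
    ¬ ∀ u : ℝ, Real.exp (β * u ^ 2) =
      ‖(Real.exp (-(k / 4) * u ^ 2) : ℂ) + (Complex.I * (a * u : ℝ)) ^ k‖ := by
  intro h
  have hle (u : ℝ) : ‖(Real.exp (-(k / 4) * u ^ 2) : ℂ)‖ ≤ 1 := by
    rw [Complex.norm_real, Real.norm_eq_abs, Real.abs_exp, Real.exp_le_one_iff]
    have : 0 ≤ (k : ℝ) / 4 * u ^ 2 := by positivity
    linarith
  have hpow {u : ℝ} (hu : 0 ≤ u) : ‖(Complex.I * (a * u : ℝ)) ^ k‖ = (a * u) ^ k := by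
    rw [norm_pow, norm_mul, Complex.norm_I, one_mul, Complex.norm_real, Real.norm_eq_abs,
      abs_of_nonneg (by positivity)]
  rcases le_or_gt β 0 with hβ | hβ
  · have hu : 0 ≤ 3 / a := by positivity
    have h1 := norm_sub_le_norm_add ((Complex.I * (a * (3 / a) : ℝ)) ^ k)
      (Real.exp (-(k / 4) * (3 / a) ^ 2) : ℂ)
    rw [add_comm ((Complex.I * _) ^ k), ← h, hpow hu, mul_div_cancel₀ _ ha.ne'] at h1
    have h2 : Real.exp (β * (3 / a) ^ 2) ≤ 1 :=
      Real.exp_le_one_iff.mpr (mul_nonpos_of_nonpos_of_nonneg hβ (sq_nonneg _))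
    have h3 : (3 : ℝ) ≤ 3 ^ k := le_self_pow₀ (by norm_num) hk
    linarith [hle (3 / a)]
  · have hconst := isLittleO_pow_exp_pos_mul_atTop 0 hβ
    have hmono := (isLittleO_pow_exp_pos_mul_atTop k hβ).const_mul_left (a ^ k)
    have hev := (hconst.add hmono).bound (c := 1 / 2) (by norm_num)
    obtain ⟨u, hu, hu1⟩ := (hev.and (Filter.eventually_ge_atTop 1)).exists
    have hu0 : 0 ≤ u := by linarith
    rw [← mul_pow, pow_zero, Real.norm_of_nonneg (by positivity),
      Real.norm_of_nonneg (Real.exp_pos _).le] at hu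
    have h1 := norm_add_le (Real.exp (-(k / 4) * u ^ 2) : ℂ) ((Complex.I * (a * u : ℝ)) ^ k)
    rw [← h, hpow hu0] at h1
    have h2 : Real.exp (β * u) ≤ Real.exp (β * u ^ 2) := by
      gcongr
      nlinarith
    linarith [hle u, Real.exp_pos (β * u)]

/-- The coefficient of `X_{p,l+1}` in `Y₁ + ⋯ + Y_k`. -/
noncomputable def sumYCoeff (k : ℕ) (p : ℤ) (l : Fin k) : ℝ :=
  ∑ i : Fin k, if ((i : ℕ) : ℤ) + 1 + ((l.rev : ℕ) : ℤ) = p then 1 else 0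

lemma sumYCoeff_self (k : ℕ) (l : Fin k) : sumYCoeff k k l = 1 := by
  have h (i : Fin k) : ((i : ℕ) : ℤ) + 1 + ((l.rev : ℕ) : ℤ) = k ↔ i = l := by
    rw [Fin.val_rev, Fin.ext_iff]
    omega
  simp only [sumYCoeff, h]
  simp

lemma exists_sumYCoeff_eq_zero {k : ℕ} (hk : k ≠ 0) {p : ℤ} (hp : p ≠ k) :
    ∃ l, sumYCoeff k p l = 0 := by
  rcases hp.lt_or_gt with h | h
  · refine ⟨⟨0, by omega⟩, Finset.sum_eq_zero fun i _ => if_neg ?_⟩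
    simp only [Fin.val_rev]
    omega
  · refine ⟨⟨k - 1, by omega⟩, Finset.sum_eq_zero fun i _ => if_neg ?_⟩
    simp only [Fin.val_rev]
    omega

lemma sum_Y_eq (k : ℕ) (ω : ℤ → Fin k → ℝ) :
    ∑ i : Fin k, Y k (((i : ℕ) : ℤ) + 1) ω =
      ∑ p : Finset.Icc (1 : ℤ) (2 * k), ∑ l, sumYCoeff k p l * ω p l := by
  rw [Finset.sum_coe_sort (Finset.Icc (1 : ℤ) (2 * k)) fun p => ∑ l, sumYCoeff k p l * ω p l]
  simp only [sumYCoeff, Finset.sum_mul, ite_mul, one_mul, zero_mul]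
  rw [Finset.sum_comm]
  simp_rw [Finset.sum_comm (s := Finset.Icc (1 : ℤ) (2 * k)), Finset.sum_ite_eq]
  have hmem (l i : Fin k) :
      ((i : ℕ) : ℤ) + 1 + ((l.rev : ℕ) : ℤ) ∈ Finset.Icc (1 : ℤ) (2 * k) := by
    rw [Finset.mem_Icc]
    omega
  simp only [hmem, if_true, Y]
  rw [Finset.sum_comm, ← Equiv.sum_comp Fin.revPerm]
  simp

lemma integral_cexp_nu_smul_sumYCoeff_of_ne {k : ℕ} (hk : k ≠ 0) {p : ℤ} (hp : p ≠ k) (u : ℝ) :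
    ∫ x, Complex.exp (Complex.I * ∑ j, ((u * sumYCoeff k p j : ℝ) : ℂ) * x j) ∂nu k =
      (Real.exp (-(∑ j, sumYCoeff k p j ^ 2 / 2) * u ^ 2) : ℝ) := by
  obtain ⟨l, hl⟩ := exists_sumYCoeff_eq_zero hk hp
  have h := integral_cexp_nu k fun j => u * sumYCoeff k p j
  rw [h, Finset.prod_eq_zero (f := fun j => Complex.I * _ / _ * _) (Finset.mem_univ l)
    (by simp [hl]), add_zero, ← Complex.exp_sum]
  push_cast
  congr 1
  rw [← Finset.sum_neg_distrib, Finset.sum_mul]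
  refine Finset.sum_congr rfl fun j _ => ?_
  ring

lemma integral_cexp_nu_smul_sumYCoeff_self (k : ℕ) (u : ℝ) :
    ∫ x, Complex.exp (Complex.I * ∑ j, ((u * sumYCoeff k k j : ℝ) : ℂ) * x j) ∂nu k =
      (Real.exp (-(k / 4) * u ^ 2) : ℂ) * ((Real.exp (-(k / 4) * u ^ 2) : ℂ) +
        (Complex.I * ((2 * √2)⁻¹ * u : ℝ)) ^ k) := by
  have h := integral_cexp_nu k fun _ => u
  simp only [Finset.prod_const, Finset.card_univ, Fintype.card_fin, mul_pow,
    ← Complex.exp_nat_mul] at h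
  push_cast at h ⊢
  simp only [sumYCoeff_self, Complex.ofReal_one, mul_one]
  rw [h, mul_add, ← Complex.exp_add]
  congr 1
  · ring_nf
  · rw [show (k : ℂ) * (-u ^ 2 / 4) = -(k / 4) * u ^ 2 by ring]
    ring

/-- The characteristic function of `Y₁ + ⋯ + Y_k`. -/
lemma exists_charFun_sum_Y {k : ℕ} (hk : k ≠ 0) {μ : Measure (ℤ → Fin k → ℝ)}
    (hμ : IsIIDSeq k μ) : ∃ N : ℝ, ∀ u : ℝ,
      charFun (μ.map fun ω => ∑ i : Fin k, Y k (((i : ℕ) : ℤ) + 1) ω) u =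
        (Real.exp (N * u ^ 2) : ℂ) * ((Real.exp (-(k / 4) * u ^ 2) : ℂ) +
          (Complex.I * ((2 * √2)⁻¹ * u : ℝ)) ^ k) := by
  let I := Finset.Icc (1 : ℤ) (2 * k)
  have hkI : (k : ℤ) ∈ I := by
    simp only [I, Finset.mem_Icc]
    omega
  let p₀ : I := ⟨k, hkI⟩
  let S (x : I → Fin k → ℝ) : ℝ := ∑ p : I, ∑ l, sumYCoeff k p l * x p l
  have hS : Measurable S := by fun_prop
  have hmap : (μ.map fun ω => ∑ i : Fin k, Y k (((i : ℕ) : ℤ) + 1) ω) =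
      (Measure.pi fun _ : I => nu k).map S := by
    rw [← hμ I, Measure.map_map hS (by fun_prop)]
    congr 1 with ω
    exact sum_Y_eq k ω
  refine ⟨(∑ p ∈ Finset.univ.erase p₀, -(∑ j, sumYCoeff k p j ^ 2 / 2)) + -(k / 4), fun u => ?_⟩
  have hexp (x : I → Fin k → ℝ) : Complex.exp (u * S x * Complex.I) = ∏ p : I,
      Complex.exp (Complex.I * ∑ j, ((u * sumYCoeff k p j : ℝ) : ℂ) * x p j) := by
    rw [← Complex.exp_sum, ← Finset.mul_sum, mul_comm]
    simp only [S]
    push_cast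
    simp only [Finset.mul_sum, mul_assoc]
  rw [hmap, charFun_apply_real, integral_map hS.aemeasurable (by fun_prop)]
  simp_rw [hexp]
  rw [integral_fintype_prod_eq_prod (fun (p : I) (x : Fin k → ℝ) =>
      Complex.exp (Complex.I * ∑ j, ((u * sumYCoeff k p j : ℝ) : ℂ) * x j)),
    ← Finset.mul_prod_erase _ _ (Finset.mem_univ p₀), integral_cexp_nu_smul_sumYCoeff_self,
    Finset.prod_congr rfl fun p hp => integral_cexp_nu_smul_sumYCoeff_of_ne hk
      (fun h => Finset.ne_of_mem_erase hp (Subtype.ext h)) u,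
    ← Complex.ofReal_prod, ← Real.exp_sum, ← Finset.sum_mul, add_mul, Real.exp_add]
  push_cast
  ring

/-- For every `m ≥ k` the joint distribution of `(Y₁, …, Y_m)` is not a
Gaussian measure on `ℝ^m`: the process `{Y_n}` is not a Gaussian process. -/
theorem map_Y_not_gaussian (k : ℕ) (hk : 1 < k)
    (μ : Measure (ℤ → Fin k → ℝ)) [IsProbabilityMeasure μ]
    (hμ : IsIIDSeq k μ) (m : ℕ) (hm : k ≤ m) :
    ¬ IsGaussianMeasure
      (μ.map (fun ω (i : Fin m) => Y k (((i : ℕ) : ℤ) + 1) ω)) := by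
  intro hG
  have hk0 : k ≠ 0 := by omega
  let L : (Fin m → ℝ) →L[ℝ] ℝ :=
    ∑ i : Fin k, ContinuousLinearMap.proj (R := ℝ) (φ := fun _ : Fin m => ℝ) (i.castLE hm)
  obtain ⟨a, v, hL⟩ := hG L
  obtain ⟨N, hN⟩ := exists_charFun_sum_Y hk0 hμ
  have hY : Measurable fun ω (i : Fin m) => Y k (((i : ℕ) : ℤ) + 1) ω := by
    unfold Y
    fun_prop
  have hsum : L ∘ (fun ω (i : Fin m) => Y k (((i : ℕ) : ℤ) + 1) ω) =
      fun ω => ∑ i : Fin k, Y k (((i : ℕ) : ℤ) + 1) ω := by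
    ext ω
    simp [L]
  rw [Measure.map_map L.continuous.measurable hY, hsum] at hL
  refine not_forall_exp_mul_sq_eq_norm hk0 (a := (2 * √2)⁻¹) (by positivity) (-(v / 2) - N)
    fun u => ?_
  have h := congrArg norm (hN u)
  rw [hL, charFun_gaussianReal, norm_mul, Complex.norm_real, Real.norm_of_nonneg (Real.exp_pos _).le,
    Complex.norm_exp] at h
  have hre : (u * a * Complex.I - v * u ^ 2 / 2 : ℂ).re = -(v / 2) * u ^ 2 := by
    have : (u * a * Complex.I - v * u ^ 2 / 2 : ℂ) =
        ((-(v / 2) * u ^ 2 : ℝ) : ℂ) + (u * a : ℝ) * Complex.I := by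
      push_cast
      ring
    rw [this, Complex.add_re, Complex.ofReal_re, Complex.re_ofReal_mul, Complex.I_re, mul_zero,
      add_zero]
  rw [hre] at h
  rw [sub_mul, Real.exp_sub, h, mul_div_cancel_left₀ _ (Real.exp_pos _).ne']
end

section
/- For every integer k > 1 there exists a probability measure P on the sequence space ℤ → ℝ such that: (1) P is invariant under the two-sided shift (Sz)(n) = z(n+1) (strict stationarity); (2) for any integers n₁ < n₂ < ⋯ < n_{k-1}, the pushforward of P under z ↦ (z(n₁), …, z(n_{k-1})) is the (k-1)-fold product of the Gaussian measure N(0,k) (all (k-1)-dimensional marginals are i.i.d. Gaussian); and (3) there exists m ≥ k such that the pushforward of P under z ↦ (z(1), …, z(m)) is not a Gaussian measure on ℝ^m (the process is not Gaussian). -/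
open Real MeasureTheory ProbabilityTheory

open scoped ENNReal NNReal

section SinePerturbation

variable {ι : Type*} [Fintype ι]

/-- The product measure `γ^ι` reweighted by the density `1 + ∏ i, sin (x i)`. -/
noncomputable def sinePerturbation (ι : Type*) [Fintype ι] (γ : Measure ℝ) : Measure (ι → ℝ) :=
  (Measure.pi fun _ => γ).withDensity fun x => ENNReal.ofReal (1 + ∏ i, Real.sin (x i))

lemma one_add_prod_sin_nonneg (x : ι → ℝ) : 0 ≤ 1 + ∏ i, Real.sin (x i) := by
  have h : |∏ i, Real.sin (x i)| ≤ 1 := by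
    rw [Finset.abs_prod]
    exact Finset.prod_le_one (fun _ _ => abs_nonneg _) fun _ _ => Real.abs_sin_le_one _
  linarith [(abs_le.mp h).1]

lemma integrable_sin_mul {𝕜 : Type*} [RCLike 𝕜] {γ : Measure ℝ} {f : ℝ → 𝕜}
    (hf : Integrable f γ) : Integrable (fun x => (Real.sin x : 𝕜) * f x) γ := by
  refine hf.bdd_mul (c := 1) (by fun_prop) (Filter.Eventually.of_forall fun x => ?_)
  simpa using Real.abs_sin_le_one x

lemma integral_prod_sinePerturbation {𝕜 : Type*} [RCLike 𝕜] {γ : Measure ℝ}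
    [IsProbabilityMeasure γ] {f : ι → ℝ → 𝕜} (hf : ∀ i, Integrable (f i) γ) :
    ∫ x, ∏ i, f i (x i) ∂sinePerturbation ι γ =
      ∏ i, ∫ x, f i x ∂γ + ∏ i, ∫ x, (Real.sin x : 𝕜) * f i x ∂γ := by
  rw [sinePerturbation, integral_withDensity_eq_integral_toReal_smul (by fun_prop)
    (by simp)]
  have h (x : ι → ℝ) : (ENNReal.ofReal (1 + ∏ i, Real.sin (x i))).toReal • ∏ i, f i (x i) =
      ∏ i, f i (x i) + ∏ i, ((Real.sin (x i) : 𝕜) * f i (x i)) := by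
    rw [ENNReal.toReal_ofReal (one_add_prod_sin_nonneg x), RCLike.real_smul_eq_coe_mul,
      Finset.prod_mul_distrib]
    push_cast
    ring
  simp_rw [h]
  rw [integral_add (Integrable.fintype_prod hf)
    (Integrable.fintype_prod fun i => integrable_sin_mul (hf i)),
    integral_fintype_prod_eq_prod,
    integral_fintype_prod_eq_prod fun i x => (Real.sin x : 𝕜) * f i x]

instance [Nonempty ι] (γ : Measure ℝ) [IsProbabilityMeasure γ] :
    IsFiniteMeasure (sinePerturbation ι γ) := by
  refine isFiniteMeasure_withDensity_ofReal (Integrable.hasFiniteIntegral ?_)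
  have h : Integrable (fun x : ι → ℝ => ∏ i, Real.sin (x i)) (Measure.pi fun _ => γ) := by
    refine Integrable.fintype_prod fun i => ?_
    simpa using integrable_sin_mul (𝕜 := ℝ) (integrable_const (1 : ℝ))
  exact (integrable_const _).add h

/-- Boxes that leave some coordinate free do not see the perturbation. -/
lemma sinePerturbation_pi {γ : Measure ℝ} [IsProbabilityMeasure γ]
    (hγ : ∫ x, Real.sin x ∂γ = 0) {A : ι → Set ℝ} (hA : ∀ i, MeasurableSet (A i))
    {j : ι} (hj : A j = Set.univ) :
    sinePerturbation ι γ (Set.univ.pi A) = ∏ i, γ (A i) := by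
  classical
  have : Nonempty ι := ⟨j⟩
  have key := integral_prod_sinePerturbation (γ := γ) (f := fun i => (A i).indicator (1 : ℝ → ℝ))
    fun i => (integrable_const 1).indicator (hA i)
  have h (x : ι → ℝ) : ∏ i, (A i).indicator (1 : ℝ → ℝ) (x i) =
      (Set.univ.pi A).indicator 1 x := by
    simp only [Set.indicator_apply, Pi.one_apply, Set.mem_univ_pi]
    split_ifs with hx
    · exact Finset.prod_eq_one fun i _ => by simp [hx i]
    · push Not at hx
      obtain ⟨i, hi⟩ := hx
      exact Finset.prod_eq_zero (Finset.mem_univ i) (by simp [hi])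
  have hzero : ∏ i, ∫ x, (Real.sin x : ℝ) * (A i).indicator (1 : ℝ → ℝ) x ∂γ = 0 :=
    Finset.prod_eq_zero (Finset.mem_univ j) (by simpa [hj] using hγ)
  simp only [h] at key
  rw [integral_indicator_one (MeasurableSet.univ_pi hA)] at key
  simp only [RCLike.ofReal_real_eq_id, id_eq, hzero, add_zero,
    integral_indicator_one (hA _)] at key
  rw [← ENNReal.toReal_eq_toReal_iff' (measure_ne_top _ _)
    (ENNReal.prod_ne_top fun i _ => measure_ne_top _ _), ENNReal.toReal_prod]
  exact key

lemma isProbabilityMeasure_sinePerturbation [Nonempty ι] {γ : Measure ℝ} [IsProbabilityMeasure γ]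
    (hγ : ∫ x, Real.sin x ∂γ = 0) : IsProbabilityMeasure (sinePerturbation ι γ) := by
  obtain ⟨j⟩ := ‹Nonempty ι›
  refine ⟨?_⟩
  simpa using sinePerturbation_pi (A := fun _ : ι => Set.univ) hγ (fun _ => .univ) (j := j) rfl

end SinePerturbation

section BlockProcess

variable {k : ℕ} [NeZero k]

/-- The process obtained by concatenating independent blocks of length `k`, each with law `β`. -/
noncomputable def blockProcess (k : ℕ) [NeZero k] (β : Measure (Fin k → ℝ))
    [IsProbabilityMeasure β] : Measure (ℤ → ℝ) :=
  (Measure.infinitePi fun _ : ℤ => β).map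
    fun y n => y (Int.divModEquiv k n).1 (Int.divModEquiv k n).2

instance (β : Measure (Fin k → ℝ)) [IsProbabilityMeasure β] :
    IsProbabilityMeasure (blockProcess k β) :=
  Measure.isProbabilityMeasure_map (Measurable.aemeasurable (by fun_prop))

lemma blockProcess_map_eval (β : Measure (Fin k → ℝ)) [IsProbabilityMeasure β] {ι : Type*}
    (n : ι → ℤ) :
    (blockProcess k β).map (fun z i => z (n i)) = (Measure.infinitePi fun _ : ℤ => β).map
      fun y i => y (Int.divModEquiv k (n i)).1 (Int.divModEquiv k (n i)).2 := by
  rw [blockProcess, Measure.map_map (by fun_prop) (by fun_prop)]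
  rfl

lemma divModEquiv_add_self (n : ℤ) :
    Int.divModEquiv k (n + k) = ((Int.divModEquiv k n).1 + 1, (Int.divModEquiv k n).2) := by
  rw [← Equiv.eq_symm_apply]
  conv_lhs => rw [← (Int.divModEquiv k).symm_apply_apply n]
  simp only [Int.divModEquiv_symm_apply]
  ring

lemma blockProcess_map_add (β : Measure (Fin k → ℝ)) [IsProbabilityMeasure β] :
    (blockProcess k β).map (fun z (n : ℤ) => z (n + k)) = blockProcess k β := by
  rw [blockProcess_map_eval, blockProcess]
  conv_rhs => rw [← Measure.map_infinitePi_infinitePi_of_inj (P := fun _ : ℤ => β)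
    (add_left_injective (1 : ℤ)), Measure.map_map (by fun_prop) (by fun_prop)]
  simp only [divModEquiv_add_self]
  rfl

/-- A block read off in full has law `β`. -/
lemma blockProcess_map_block (β : Measure (Fin k → ℝ)) [IsProbabilityMeasure β] {n : Fin k → ℤ}
    (b : ℤ) (hn : ∀ i, Int.divModEquiv k (n i) = (b, i)) :
    (blockProcess k β).map (fun z i => z (n i)) = β := by
  rw [blockProcess_map_eval]
  simp only [hn]
  exact Measure.infinitePi_map_eval (fun _ : ℤ => β) b

/-- If boxes with a free coordinate have the same mass under `β` as under `γ^k`, then any family of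
coordinates missing a place in every block is i.i.d. with law `γ`. -/
lemma blockProcess_map_eq_pi {γ : Measure ℝ} [IsProbabilityMeasure γ] {β : Measure (Fin k → ℝ)}
    [IsProbabilityMeasure β]
    (hβ : ∀ (A : Fin k → Set ℝ) (j : Fin k), (∀ i, MeasurableSet (A i)) → A j = Set.univ →
      β (Set.univ.pi A) = ∏ i, γ (A i))
    {ι : Type*} [Fintype ι] {n : ι → ℤ} (hn : Function.Injective n)
    (hmiss : ∀ b, ∃ r, ∀ i, Int.divModEquiv k (n i) ≠ (b, r)) :
    (blockProcess k β).map (fun z i => z (n i)) = Measure.pi fun _ => γ := by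
  classical
  rw [blockProcess_map_eval]
  symm
  refine Measure.pi_eq fun s hs => ?_
  set e : ι → ℤ × Fin k := fun i => Int.divModEquiv k (n i) with he
  have hinj : Function.Injective e := (Int.divModEquiv k).injective.comp hn
  let A : ℤ × Fin k → Set ℝ := fun p => ⋂ (i) (_ : e i = p), s i
  have hA (p) : MeasurableSet (A p) := .iInter fun i => .iInter fun _ => hs i
  have hAe (i) : A (e i) = s i := by
    ext x
    simp only [A, Set.mem_iInter]
    exact ⟨fun h => h i rfl, fun h j hj => hinj hj ▸ h⟩
  have hAuniv (p) (hp : ∀ i, e i ≠ p) : A p = Set.univ := by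
    simp [A, hp]
  let B : Finset ℤ := Finset.univ.image fun i => (e i).1
  have hpre : (fun (y : ℤ → Fin k → ℝ) i => y (e i).1 (e i).2) ⁻¹' Set.univ.pi s =
      Set.pi B fun b => Set.univ.pi fun r => A (b, r) := by
    ext y
    simp only [Set.mem_preimage, Set.mem_pi, Set.mem_univ, true_imp_iff, A, Set.mem_iInter]
    constructor
    · rintro h b - r i hi
      simpa [hi] using h i
    · intro h i
      exact h (e i).1 (by simp [B]) (e i).2 i rfl
  rw [Measure.map_apply (by fun_prop) (.univ_pi hs), hpre,
    Measure.infinitePi_pi (μ := fun _ : ℤ => β) (t := fun b => Set.univ.pi fun r => A (b, r))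
      fun b _ => .univ_pi fun r => hA (b, r)]
  have hblock (b : ℤ) : β (Set.univ.pi fun r => A (b, r)) = ∏ r, γ (A (b, r)) := by
    obtain ⟨r, hr⟩ := hmiss b
    exact hβ _ r (fun _ => hA _) (hAuniv _ hr)
  simp only [hblock]
  rw [← Finset.prod_product']
  calc ∏ p ∈ B ×ˢ Finset.univ, γ (A p)
      = ∏ p ∈ Finset.univ.image e, γ (A p) := by
        refine (Finset.prod_subset (fun p hp => ?_) fun p _ hp => ?_).symm
        · obtain ⟨i, -, rfl⟩ := Finset.mem_image.mp hp
          simp [B]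
        · rw [hAuniv p (by simpa using hp), measure_univ]
    _ = ∏ i, γ (s i) := by
        rw [Finset.prod_image hinj.injOn]
        simp only [hAe]

end BlockProcess

section PhaseAverage

/-- The average of the first `k` shifts of a process. -/
noncomputable def phaseAverage (k : ℕ) (Q : Measure (ℤ → ℝ)) : Measure (ℤ → ℝ) :=
  (k : ℝ≥0∞)⁻¹ • ∑ u ∈ Finset.range k, Q.map fun z n => z (n + u)

lemma phaseAverage_map_eval (k : ℕ) (Q : Measure (ℤ → ℝ)) {ι : Type*} (n : ι → ℤ) :
    (phaseAverage k Q).map (fun z i => z (n i)) =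
      (k : ℝ≥0∞)⁻¹ • ∑ u ∈ Finset.range k, Q.map fun z i => z (n i + u) := by
  rw [phaseAverage, Measure.map_smul, Measure.map_finset_sum (Measurable.aemeasurable (by fun_prop))]
  congr 1
  refine Finset.sum_congr rfl fun u _ => ?_
  rw [Measure.map_map (by fun_prop) (by fun_prop)]
  rfl

lemma smul_sum_range_const {α : Type*} [MeasurableSpace α] (k : ℕ) [NeZero k] (μ : Measure α) :
    (k : ℝ≥0∞)⁻¹ • ∑ _u ∈ Finset.range k, μ = μ := by
  rw [Finset.sum_const, Finset.card_range, ← Nat.cast_smul_eq_nsmul ℝ≥0∞, smul_smul,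
    ENNReal.inv_mul_cancel (by simp [NeZero.ne]) (by simp), one_smul]

lemma isProbabilityMeasure_phaseAverage (k : ℕ) [NeZero k] (Q : Measure (ℤ → ℝ))
    [IsProbabilityMeasure Q] : IsProbabilityMeasure (phaseAverage k Q) := by
  refine ⟨?_⟩
  have (u : ℕ) : Q.map (fun (z : ℤ → ℝ) (n : ℤ) => z (n + u)) Set.univ = 1 := by
    rw [Measure.map_apply (by fun_prop) .univ, Set.preimage_univ, measure_univ]
  simp only [phaseAverage, Measure.smul_apply, Measure.finsetSum_apply, this, smul_eq_mul,
    Finset.sum_const, Finset.card_range, nsmul_eq_mul, mul_one]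
  exact ENNReal.inv_mul_cancel (by simp [NeZero.ne]) (by simp)

lemma phaseAverage_map_shift {k : ℕ} {Q : Measure (ℤ → ℝ)}
    (hQ : Q.map (fun z (n : ℤ) => z (n + k)) = Q) :
    (phaseAverage k Q).map (fun z n => z (n + 1)) = phaseAverage k Q := by
  rw [phaseAverage_map_eval, phaseAverage]
  congr 1
  have h (u : ℕ) : (Q.map fun z (n : ℤ) => z (n + 1 + u)) =
      Q.map fun z (n : ℤ) => z (n + (u + 1 : ℕ)) := by
    congr! 4 with z n
    push_cast
    ring
  have hz : (Q.map fun z (n : ℤ) => z (n + (0 : ℕ))) = Q.map fun z (n : ℤ) => z (n + k) := by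
    rw [hQ]
    simp
  simp only [h]
  cases k with
  | zero => simp
  | succ p => rw [Finset.sum_range_succ, Finset.sum_range_succ', hz]

end PhaseAverage

section Gaussian

lemma charFunDual_add_mul_charFunDual_sub {E : Type*} [NormedAddCommGroup E] [NormedSpace ℝ E]
    [MeasurableSpace E] [BorelSpace E] (μ : Measure E) [IsGaussian μ] (L M : StrongDual ℝ E) :
    charFunDual μ (L + M) * charFunDual μ (L - M) =
      charFunDual μ L ^ 2 * (charFunDual μ M * charFunDual μ (-M)) := by
  have hL := IsGaussian.memLp_dual μ L 2 (by simp)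
  have hM := IsGaussian.memLp_dual μ M 2 (by simp)
  have iL := IsGaussian.integrable_dual μ L
  have iM := IsGaussian.integrable_dual μ M
  have hadd : Var[⇑(L + M); μ] = Var[⇑L; μ] + 2 * cov[⇑L, ⇑M; μ] + Var[⇑M; μ] :=
    variance_add hL hM
  have hsub : Var[⇑(L - M); μ] = Var[⇑L; μ] - 2 * cov[⇑L, ⇑M; μ] + Var[⇑M; μ] :=
    variance_sub hL hM
  have hneg : Var[⇑(-M); μ] = Var[⇑M; μ] := variance_neg
  have eadd : μ[⇑(L + M)] = μ[⇑L] + μ[⇑M] := integral_add iL iM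
  have esub : μ[⇑(L - M)] = μ[⇑L] - μ[⇑M] := integral_sub iL iM
  have eneg : μ[⇑(-M)] = -μ[⇑M] := integral_neg _
  simp only [IsGaussian.charFunDual_eq, integral_complex_ofReal, hadd, hsub, hneg, eadd, esub, eneg, ← Complex.exp_add,
    ← Complex.exp_nat_mul]
  congr 1
  push_cast
  ring

lemma integral_sin_mul_cexp {γ : Measure ℝ} [IsProbabilityMeasure γ] (t : ℝ) :
    ∫ x : ℝ, (Real.sin x : ℂ) * Complex.exp (t * x * Complex.I) ∂γ =
      (charFun γ (t - 1) - charFun γ (t + 1)) * Complex.I / 2 := by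
  have hint (s : ℝ) : Integrable (fun x : ℝ => Complex.exp (s * x * Complex.I)) γ := by
    refine Integrable.of_bound (C := 1) (by fun_prop) (Filter.Eventually.of_forall fun x => ?_)
    rw [← Complex.ofReal_mul, Complex.norm_exp_ofReal_mul_I]
  rw [charFun_apply_real, charFun_apply_real, ← integral_sub (hint _) (hint _),
    ← integral_mul_const, ← integral_div]
  congr 1 with x
  rw [Complex.ofReal_sin, Complex.sin]
  have h1 : ((t - 1 : ℝ) : ℂ) * x * Complex.I = t * x * Complex.I + -x * Complex.I := by
    push_cast; ring
  have h2 : ((t + 1 : ℝ) : ℂ) * x * Complex.I = t * x * Complex.I + x * Complex.I := by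
    push_cast; ring
  rw [h1, h2, Complex.exp_add, Complex.exp_add]
  ring

variable {ι : Type*} [Fintype ι]

/-- The linear functional `x ↦ ∑ i, t i * x i`. -/
noncomputable def linearFunctional (t : ι → ℝ) : StrongDual ℝ (ι → ℝ) :=
  ∑ i, t i • ContinuousLinearMap.proj i

lemma linearFunctional_apply (t x : ι → ℝ) : linearFunctional t x = ∑ i, t i * x i := by
  simp [linearFunctional]

lemma cexp_linearFunctional (t x : ι → ℝ) :
    Complex.exp (linearFunctional t x * Complex.I) =
      ∏ i, Complex.exp (t i * x i * Complex.I) := by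
  rw [← Complex.exp_sum, linearFunctional_apply]
  push_cast
  rw [Finset.sum_mul]

lemma charFunDual_pi_linearFunctional (γ : Measure ℝ) [IsProbabilityMeasure γ] (t : ι → ℝ) :
    charFunDual (Measure.pi fun _ => γ) (linearFunctional t) = ∏ i, charFun γ (t i) := by
  simp only [charFunDual_apply, cexp_linearFunctional, charFun_apply_real]
  exact integral_fintype_prod_eq_prod fun i (x : ℝ) => Complex.exp (t i * x * Complex.I)

lemma charFunDual_sinePerturbation (γ : Measure ℝ) [IsProbabilityMeasure γ] (t : ι → ℝ) :
    charFunDual (sinePerturbation ι γ) (linearFunctional t) = ∏ i, charFun γ (t i) +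
      ∏ i, (charFun γ (t i - 1) - charFun γ (t i + 1)) * Complex.I / 2 := by
  simp only [charFunDual_apply, cexp_linearFunctional, ← integral_sin_mul_cexp]
  simp only [charFun_apply_real]
  refine integral_prod_sinePerturbation (𝕜 := ℂ)
    (f := fun i (x : ℝ) => Complex.exp (t i * x * Complex.I)) fun i => ?_
  refine Integrable.of_bound (C := 1) (by fun_prop) (Filter.Eventually.of_forall fun x => ?_)
  rw [← Complex.ofReal_mul, Complex.norm_exp_ofReal_mul_I]

lemma charFun_gaussianReal_zero (v : ℝ≥0) (t : ℝ) :
    charFun (gaussianReal 0 v) t = Real.exp (-(v * t ^ 2 / 2)) := by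
  rw [charFun_gaussianReal]
  push_cast
  congr 1
  ring

lemma integral_sin_gaussianReal (v : ℝ≥0) : ∫ x, Real.sin x ∂gaussianReal 0 v = 0 := by
  have h := integral_sin_mul_cexp (γ := gaussianReal 0 v) 0
  simp only [Complex.ofReal_zero, zero_mul, Complex.exp_zero, mul_one, integral_complex_ofReal,
    charFun_gaussianReal_zero] at h
  simpa using h

/-- A nontrivial mixture of `γ^k` and its sine perturbation is not Gaussian. -/
lemma not_isGaussian_mixture {p : ℕ} (hp : p ≠ 0) {v : ℝ≥0} (hv : v ≠ 0) {c : ℂ} (hc : c ≠ 0)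
    {ν : Measure (Fin (p + 1) → ℝ)}
    (hν : ∀ t, charFunDual ν (linearFunctional t) = ∏ i, charFun (gaussianReal 0 v) (t i) +
      c * ∏ i, (charFun (gaussianReal 0 v) (t i - 1) - charFun (gaussianReal 0 v) (t i + 1)) *
        Complex.I / 2) : ¬ IsGaussian ν := by
  intro hG
  let L : StrongDual ℝ (Fin (p + 1) → ℝ) := linearFunctional (Fin.cons 0 fun _ => 1)
  let M (s : ℝ) : StrongDual ℝ (Fin (p + 1) → ℝ) := linearFunctional (Fin.cons s fun _ => 0)
  have hadd : L + M 1 = linearFunctional (Fin.cons 1 fun _ => 1) := by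
    ext x
    simp [L, M, linearFunctional_apply, Fin.sum_univ_succ, add_comm]
  have hsub : L - M 1 = linearFunctional (Fin.cons (-1) fun _ => 1) := by
    ext x
    simp [L, M, linearFunctional_apply, Fin.sum_univ_succ, add_comm, sub_eq_add_neg]
  have hneg : -M 1 = M (-1) := by
    ext x
    simp [M, linearFunctional_apply, Fin.sum_univ_succ]
  have h := charFunDual_add_mul_charFunDual_sub ν L (M 1)
  rw [hadd, hsub, hneg] at h
  simp only [L, M, hν, Fin.prod_univ_succ, Fin.cons_zero, Fin.cons_succ, Finset.prod_const,
    Finset.card_univ, Fintype.card_fin, charFun_gaussianReal_zero] at h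
  norm_num [hp] at h
  set b : ℂ := Complex.exp (-(v * 4 / 2)) with hb
  have hb1 : b ≠ 1 := by
    have hv' : (0 : ℝ) < v := by positivity
    have h1 : Real.exp (-(v * 4 / 2)) ≠ 1 := by
      rw [Ne, Real.exp_eq_one_iff]
      linarith
    rw [hb]
    exact_mod_cast h1
  have hd : (1 - b) * Complex.I / 2 ≠ 0 := by
    simp [sub_eq_zero, hb1.symm]
  have hd' : (b - 1) * Complex.I / 2 = -((1 - b) * Complex.I / 2) := by ring
  rw [hd'] at h
  refine pow_ne_zero 2 (mul_ne_zero hc (pow_ne_zero (p + 1) hd)) ?_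
  linear_combination -h

end Gaussian

section SineProcess

/-- The concatenation of sine-perturbed Gaussian blocks of length `p + 1`, with uniformly random
phase. -/
noncomputable def sineProcess (p : ℕ) (v : ℝ≥0) : Measure (ℤ → ℝ) :=
  haveI := isProbabilityMeasure_sinePerturbation (ι := Fin (p + 1)) (integral_sin_gaussianReal v)
  phaseAverage (p + 1) (blockProcess (p + 1) (sinePerturbation (Fin (p + 1)) (gaussianReal 0 v)))

variable {p : ℕ} {v : ℝ≥0}

instance : IsProbabilityMeasure (sineProcess p v) :=
  haveI := isProbabilityMeasure_sinePerturbation (ι := Fin (p + 1)) (integral_sin_gaussianReal v)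
  isProbabilityMeasure_phaseAverage _ _

lemma sineProcess_map_shift : (sineProcess p v).map (fun z n => z (n + 1)) = sineProcess p v :=
  haveI := isProbabilityMeasure_sinePerturbation (ι := Fin (p + 1)) (integral_sin_gaussianReal v)
  phaseAverage_map_shift (blockProcess_map_add _)

lemma sineProcess_map_eq_pi {n : Fin p → ℤ} (hn : Function.Injective n) :
    (sineProcess p v).map (fun z i => z (n i)) = Measure.pi fun _ => gaussianReal 0 v := by
  have := isProbabilityMeasure_sinePerturbation (ι := Fin (p + 1)) (integral_sin_gaussianReal v)
  rw [sineProcess, phaseAverage_map_eval]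
  refine Eq.trans ?_ (smul_sum_range_const (p + 1) _)
  congr 1
  refine Finset.sum_congr rfl fun u _ => ?_
  refine blockProcess_map_eq_pi
    (fun A j hA hj => sinePerturbation_pi (integral_sin_gaussianReal v) hA hj)
    ((add_left_injective (u : ℤ)).comp hn) fun b => ?_
  have hsurj : ¬ Function.Surjective fun i => (Int.divModEquiv (p + 1) (n i + u)).2 := by
    intro h
    simpa using Fintype.card_le_of_surjective _ h
  simp only [Function.Surjective, not_forall, not_exists] at hsurj
  obtain ⟨r, hr⟩ := hsurj
  exact ⟨r, fun i hi => hr i (congrArg Prod.snd hi)⟩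

/-- The window `1, …, p + 1` of the sine process is a full block for exactly one phase. -/
lemma sineProcess_map_window :
    (sineProcess p v).map (fun z (i : Fin (p + 1)) => z (((i : ℕ) : ℤ) + 1)) =
      ((p + 1 : ℕ) : ℝ≥0∞)⁻¹ • (∑ _u ∈ Finset.range p, Measure.pi (fun _ => gaussianReal 0 v) +
        sinePerturbation (Fin (p + 1)) (gaussianReal 0 v)) := by
  have := isProbabilityMeasure_sinePerturbation (ι := Fin (p + 1)) (integral_sin_gaussianReal v)
  rw [sineProcess, phaseAverage_map_eval, Finset.sum_range_succ]
  congr 2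
  · refine Finset.sum_congr rfl fun u hu => ?_
    have hu : u < p := Finset.mem_range.mp hu
    refine blockProcess_map_eq_pi
      (fun A j hA hj => sinePerturbation_pi (integral_sin_gaussianReal v) hA hj)
      (fun i j hij => Fin.ext (by lia)) fun b => ?_
    refine ⟨if b = 0 then 0 else Fin.last p, fun i hi => ?_⟩
    have hi' := (Equiv.eq_symm_apply _).mpr hi
    have hlt := i.is_lt
    rw [Int.divModEquiv_symm_apply] at hi'
    split_ifs at hi' with hb
    · simp [hb] at hi'
      omega
    · simp only [Fin.val_last] at hi'
      push_cast at hi'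
      rcases lt_or_gt_of_ne hb with hb | hb <;> nlinarith
  · refine blockProcess_map_block _ 1 fun i => ?_
    rw [← Equiv.eq_symm_apply, Int.divModEquiv_symm_apply]
    push_cast
    ring

lemma charFunDual_sineProcess_window (t : Fin (p + 1) → ℝ) :
    charFunDual ((sineProcess p v).map fun z (i : Fin (p + 1)) => z (((i : ℕ) : ℤ) + 1))
        (linearFunctional t) =
      ∏ i, charFun (gaussianReal 0 v) (t i) + ((p + 1 : ℕ) : ℂ)⁻¹ *
        ∏ i, (charFun (gaussianReal 0 v) (t i - 1) - charFun (gaussianReal 0 v) (t i + 1)) *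
          Complex.I / 2 := by
  have hint (μ : Measure (Fin (p + 1) → ℝ)) [IsFiniteMeasure μ] :
      Integrable (fun x => Complex.exp (linearFunctional t x * Complex.I)) μ := by
    refine Integrable.of_bound (C := 1) (by fun_prop) (Filter.Eventually.of_forall fun x => ?_)
    rw [Complex.norm_exp_ofReal_mul_I]
  rw [sineProcess_map_window, charFunDual_apply, integral_smul_measure,
    integral_add_measure (integrable_finsetSum_measure.mpr fun _ _ => hint _) (hint _),
    integral_finsetSum_measure fun _ _ => hint _, ← charFunDual_apply, ← charFunDual_apply,
    charFunDual_pi_linearFunctional, charFunDual_sinePerturbation, Finset.sum_const,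
    Finset.card_range]
  have hp : (p : ℂ) + 1 ≠ 0 := by exact_mod_cast p.succ_ne_zero
  simp only [ENNReal.toReal_inv, ENNReal.toReal_natCast, Complex.real_smul, nsmul_eq_mul]
  push_cast
  rw [← add_assoc, ← add_one_mul, mul_add, inv_mul_cancel_left₀ hp]

end SineProcess

/-- For every `k > 1` there is a strictly stationary, nongaussian process in
discrete time all of whose `(k-1)`-dimensional marginals are i.i.d. `N(0,k)`. -/
theorem exists_stationary_nongaussian_process (k : ℕ) (hk : 1 < k) :
    ∃ P : Measure (ℤ → ℝ), IsProbabilityMeasure P ∧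
      -- (1) strict stationarity: invariance under the two-sided shift
      P.map (fun (z : ℤ → ℝ) n => z (n + 1)) = P ∧
      -- (2) every (k-1)-dimensional marginal is the product of N(0,k)'s
      (∀ n : Fin (k - 1) → ℤ, StrictMono n →
        P.map (fun (z : ℤ → ℝ) (i : Fin (k - 1)) => z (n i)) =
          Measure.pi (fun _ : Fin (k - 1) => gaussianReal 0 (k : NNReal))) ∧
      -- (3) some finite-dimensional marginal is not Gaussian
      ∃ m : ℕ, k ≤ m ∧
        ¬ IsGaussianMeasure
          (P.map (fun (z : ℤ → ℝ) (i : Fin m) => z (((i : ℕ) : ℤ) + 1))) := by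
  obtain ⟨p, rfl⟩ : ∃ p, k = p + 1 := ⟨k - 1, by omega⟩
  refine ⟨sineProcess p ((p + 1 : ℕ) : NNReal), inferInstance, sineProcess_map_shift,
    fun n hn => sineProcess_map_eq_pi hn.injective, p + 1, le_rfl, fun h => ?_⟩
  refine not_isGaussian_mixture (by omega) (by positivity) ?_ charFunDual_sineProcess_window
    (isGaussian_of_map_eq_gaussianReal h)
  exact inv_ne_zero (by exact_mod_cast p.succ_ne_zero)
end
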